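/- arXiv:2603.07172 — 2 statements merged into one kernel-verified Lean document; each statement's English description precedes it below -/
import Mathlib

section
/- Let k ≥ 3 and let m be an integer with 1 ≤ m ≤ k-2. Then, as rational numbers, L_{-mk}^{(k)} = (m+5)·2^(m-2). -/
/-- `L : ℤ → ℤ` is the `k`-generalized Lucas sequence: it satisfies the order-`k`
recurrence everywhere, with `L 0 = 2`, `L 1 = 1`, and `L n = 0` for `-(k-2) ≤ n ≤ -1`. -/
def IsGenLucas (k : ℕ) (L : ℤ → ℤ) : Prop :=
  (∀ n : ℤ, L n = ∑ i ∈ Finset.Icc 1 k, L (n - (i : ℤ))) ∧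
  L 0 = 2 ∧ L 1 = 1 ∧ ∀ n : ℤ, -((k : ℤ) - 2) ≤ n → n ≤ -1 → L n = 0

namespace IsGenLucas

variable {k : ℕ} {L : ℤ → ℤ}

theorem eq_sum_range (hL : IsGenLucas k L) (n : ℤ) :
    L n = ∑ i ∈ Finset.range k, L (n - (i + 1)) := by
  rw [hL.1 n, Finset.range_eq_Ico, ← Finset.Ico_add_one_right_eq_Icc,
    ← Finset.sum_Ico_add' (fun i : ℕ => L (n - (i : ℤ))) 0 k 1]
  simp

/-- Subtracting consecutive instances of the recurrence gives a three-term relation. -/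
theorem sub_add_one (hL : IsGenLucas k L) (n : ℤ) :
    L (n - (k + 1)) = 2 * L (n - 1) - L n := by
  have h := Finset.sum_range_succ (fun i : ℕ => L (n - ((i : ℤ) + 1))) k
  rw [Finset.sum_range_succ', ← hL.eq_sum_range n] at h
  have h' := hL.eq_sum_range (n - 1)
  have e : ∀ i : ℕ, n - (((i + 1 : ℕ) : ℤ) + 1) = n - 1 - ((i : ℤ) + 1) := by
    intro i; push_cast; ring
  simp only [e, ← h', Nat.cast_zero, zero_add] at h
  linarith

theorem apply_one_sub (hL : IsGenLucas k L) (hk : 2 ≤ k) : L (1 - k) = -1 := by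
  obtain ⟨t, rfl⟩ := Nat.exists_eq_add_of_le' hk
  have h := hL.eq_sum_range 1
  rw [Finset.sum_range_succ, Finset.sum_range_succ', Finset.sum_eq_zero] at h
  · have e : (1 : ℤ) - ((t + 1 : ℕ) + 1) = 1 - (t + 2 : ℕ) := by push_cast; ring
    rw [e] at h
    simp only [hL.2.2.1, Nat.cast_zero, zero_add, sub_self, hL.2.1] at h
    linarith
  · intro i hi
    have := Finset.mem_range.1 hi
    apply hL.2.2.2 <;> push_cast <;> omega

theorem apply_neg_mul (hL : IsGenLucas k L) (m : ℕ) (hm : m + 3 ≤ k) :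
    4 * L (-((m + 1) * k)) = (m + 6) * 2 ^ (m + 1) ∧
    L (1 - (m + 1) * k) = -2 ^ m ∧
    ∀ i : ℤ, 2 ≤ i → i ≤ k - (m + 1) → L (i - (m + 1) * k) = 0 := by
  induction m with
  | zero =>
    refine ⟨?_, ?_, fun i h2 hi => hL.2.2.2 _ ?_ ?_⟩
    · have h := hL.sub_add_one 1
      rw [show (1 : ℤ) - (k + 1) = -k by ring, sub_self, hL.2.1, hL.2.2.1] at h
      simp [h]
    · simpa using hL.apply_one_sub (by omega)
    · push_cast at hi ⊢; linarith
    · push_cast at hi ⊢; linarith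
  | succ m ih =>
    obtain ⟨h0, h1, h2⟩ := ih (by omega)
    have step : ∀ i : ℤ, L (i - ((m + 1 : ℕ) + 1) * k) =
        2 * L (i - (m + 1) * k) - L (i + 1 - (m + 1) * k) := by
      intro i
      have h := hL.sub_add_one (i + 1 - (m + 1) * k)
      rw [show i + 1 - (m + 1) * k - 1 = i - (m + 1) * (k : ℤ) by ring] at h
      rw [← h]
      congr 1
      push_cast
      ring
    refine ⟨?_, ?_, fun i hi hi' => ?_⟩
    · have h := step 0
      simp only [zero_sub, zero_add] at h
      rw [h, h1, mul_sub, mul_left_comm, h0]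
      push_cast
      ring
    · rw [step, h1, one_add_one_eq_two, h2 2 le_rfl (by omega)]
      ring
    · push_cast at hi'
      rw [step, h2 i hi (by linarith), h2 (i + 1) (by linarith) (by linarith)]
      ring

end IsGenLucas

theorem value_at_mk (k : ℕ) (hk : 3 ≤ k) (L : ℤ → ℤ) (hL : IsGenLucas k L)
    (m : ℤ) (hm1 : 1 ≤ m) (hm2 : m ≤ (k : ℤ) - 2) :
    (L (-(m * k)) : ℚ) = (m + 5 : ℚ) * (2 : ℚ) ^ (m - 2) := by
  obtain ⟨n, rfl⟩ : ∃ n : ℕ, m = n + 1 := ⟨(m - 1).toNat, by omega⟩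
  have h := (hL.apply_neg_mul n (by omega)).1
  have hq : (4 : ℚ) * L (-((n + 1) * k)) = (n + 6) * 2 ^ (n + 1) := by exact_mod_cast h
  rw [zpow_sub₀ two_ne_zero]
  have e : (2 : ℚ) ^ ((n : ℤ) + 1) = 2 ^ (n + 1) := by exact_mod_cast zpow_natCast (2 : ℚ) (n + 1)
  rw [e]
  push_cast
  linarith
end

section
/- Let k ≥ 3 and let j, r be integers with 0 ≤ j ≤ k-2 and 0 ≤ r ≤ k-2. Then, as rational numbers, L_{-(k²-k-1+(j-1)k+r)}^{(k)} = (-1)^(r+1) · ( ψ(k+j-3, r-2)·2^(k+j-r-1) + ψ(k+j-3, r-1)·2^(k+j-r-3) ) + (-1)^(k+r+1) · ( ψ(k+j-4, k+r-2)·2^(j-r-2) + ψ(k+j-4, k+r-1)·2^(j-r-4) ). -/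
/-- Extended binomial coefficient: `C a b = a.choose b` when `0 ≤ b ≤ a`, and `0` otherwise. -/
def C (a b : ℤ) : ℤ := if 0 ≤ b ∧ b ≤ a then (a.toNat).choose b.toNat else 0

/-- `ψ(y, z) = C(y, z) + C(y+1, z+1)`. -/
def psi (y z : ℤ) : ℤ := C y z + C (y + 1) (z + 1)

/-- Pascal's rule for `C`, valid away from the apex of the triangle. -/
lemma C_pascal (a b : ℤ) (h : a ≠ -1 ∨ b ≠ 0) : C (a + 1) b = C a b + C a (b - 1) := by
  rcases lt_or_ge a 0 with ha | ha
  · rw [C, C, C, if_neg, if_neg, if_neg] <;> omega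
  rcases lt_trichotomy b 0 with hb | hb | hb
  · rw [C, C, C, if_neg, if_neg, if_neg] <;> omega
  · subst hb
    rw [C, C, C, if_pos, if_pos, if_neg] <;> first | omega | simp
  · obtain ⟨m, rfl⟩ := Int.eq_ofNat_of_zero_le ha
    obtain ⟨c, rfl⟩ : ∃ c : ℕ, b = c + 1 := ⟨(b - 1).toNat, by omega⟩
    have key (x y : ℕ) : C x y = x.choose y := by
      unfold C
      split_ifs with hxy
      · simp
      · rw [Nat.choose_eq_zero_of_lt (by omega)]; simp
    have h₁ := key (m + 1) (c + 1)
    have h₂ := key m (c + 1)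
    have h₃ := key m c
    push_cast at h₁ h₂
    rw [h₁, h₂, add_sub_cancel_right, h₃, Nat.choose_succ_succ]
    push_cast
    ring

lemma C_eq_zero_of_lt {a b : ℤ} (h : a < b) : C a b = 0 := by
  rw [C, if_neg (by omega)]

lemma C_eq_zero_of_neg {a b : ℤ} (h : b < 0) : C a b = 0 := by
  rw [C, if_neg (by omega)]

/-- The coefficient of `x ^ t` in `(2 - x) ^ q` (zero for `q < 0`). -/
def twoSubCoeff (q t : ℤ) : ℚ := (-1) ^ t * 2 ^ (q - t) * C q t

lemma twoSubCoeff_succ (q t : ℤ) (h : q ≠ -1 ∨ t ≠ 0) :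
    twoSubCoeff (q + 1) t = 2 * twoSubCoeff q t - twoSubCoeff q (t - 1) := by
  have h₁ : (2 : ℚ) ^ (q + 1 - t) = 2 ^ (q - t) * 2 := by
    rw [← zpow_add_one₀ (by norm_num)]; congr 1; ring
  have h₂ : (2 : ℚ) ^ (q - (t - 1)) = 2 ^ (q - t) * 2 := by
    rw [← zpow_add_one₀ (by norm_num)]; congr 1; ring
  have h₃ : (-1 : ℚ) ^ (t - 1) = -(-1) ^ t := by
    rw [zpow_sub_one₀ (by norm_num)]; norm_num
  simp only [twoSubCoeff, h₁, h₂, h₃, C_pascal q t h]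
  push_cast
  ring

lemma twoSubCoeff_eq_zero_of_lt {q t : ℤ} (h : q < t) : twoSubCoeff q t = 0 := by
  simp [twoSubCoeff, C_eq_zero_of_lt h]

lemma twoSubCoeff_eq_zero_of_neg {q t : ℤ} (h : t < 0) : twoSubCoeff q t = 0 := by
  simp [twoSubCoeff, C_eq_zero_of_neg h]

/-- The coefficient of `x ^ t` in `(2 - x) ^ (q - 1) * ((1 + 2 * x) * (2 - x) - 3)`. -/
def lucasCoeff (q t : ℤ) : ℚ :=
  twoSubCoeff q t + 2 * twoSubCoeff q (t - 1) - 3 * twoSubCoeff (q - 1) t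

lemma lucasCoeff_succ (q t : ℤ) (h : 1 ≤ q ∨ 2 ≤ t) :
    lucasCoeff (q + 1) t = 2 * lucasCoeff q t - lucasCoeff q (t - 1) := by
  have h₃ := twoSubCoeff_succ (q - 1) t (by omega)
  rw [sub_add_cancel] at h₃
  simp only [lucasCoeff, add_sub_cancel_right]
  rw [twoSubCoeff_succ q t (by omega), twoSubCoeff_succ q (t - 1) (by omega)]
  linear_combination (-3) * h₃

lemma lucasCoeff_eq_zero_of_lt {q t : ℤ} (h : q + 1 < t) : lucasCoeff q t = 0 := by
  rw [lucasCoeff, twoSubCoeff_eq_zero_of_lt (by omega), twoSubCoeff_eq_zero_of_lt (by omega),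
    twoSubCoeff_eq_zero_of_lt (by omega)]
  norm_num

lemma lucasCoeff_eq_zero_of_neg {q t : ℤ} (h : t < 0) : lucasCoeff q t = 0 := by
  rw [lucasCoeff, twoSubCoeff_eq_zero_of_neg (by omega), twoSubCoeff_eq_zero_of_neg (by omega),
    twoSubCoeff_eq_zero_of_neg (by omega)]
  norm_num

lemma lucasCoeff_eq_psi (q t : ℤ) (h : 1 ≤ q ∨ 2 ≤ t) :
    lucasCoeff q t = (-1) ^ (t + 1) *
      (psi (q - 1) (t - 2) * 2 ^ (q - t + 1) + psi (q - 1) (t - 1) * 2 ^ (q - t - 1)) := by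
  have p₁ := C_pascal (q - 1) t (by omega)
  have p₂ := C_pascal (q - 1) (t - 1) (by omega)
  rw [sub_add_cancel] at p₁ p₂
  rw [sub_sub, one_add_one_eq_two] at p₂
  have e₁ : (2 : ℚ) ^ (q - t) = 2 ^ (q - t - 1) * 2 := by
    rw [← zpow_add_one₀ (by norm_num)]; congr 1; ring
  have e₂ : (2 : ℚ) ^ (q - t + 1) = 2 ^ (q - t - 1) * 2 * 2 := by
    rw [← e₁, ← zpow_add_one₀ (by norm_num)]
  have s₁ : (-1 : ℚ) ^ (t - 1) = -(-1) ^ t := by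
    rw [zpow_sub_one₀ (by norm_num)]; norm_num
  have s₂ : (-1 : ℚ) ^ (t + 1) = -(-1) ^ t := by
    rw [zpow_add_one₀ (by norm_num)]; norm_num
  rw [lucasCoeff, twoSubCoeff, twoSubCoeff, twoSubCoeff, psi, psi,
    show q - (t - 1) = q - t + 1 by ring, show q - 1 - t = q - t - 1 by ring,
    show q - 1 + 1 = q by ring, show t - 2 + 1 = t - 1 by ring, sub_add_cancel,
    e₁, e₂, s₁, s₂, p₁, p₂]
  push_cast
  ring

namespace IsGenLucas

variable {k : ℕ} {L : ℤ → ℤ}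

lemma sub_order (hL : IsGenLucas k L) (n : ℤ) : L (n - k) = 2 * L n - L (n + 1) := by
  have key (m : ℤ) : L m = ∑ i ∈ Finset.range k, L (m - (i + 1 : ℕ)) := by
    rw [hL.1 m, Finset.range_eq_Ico, Finset.sum_Ico_add' (fun i : ℕ => L (m - i)) 0 k 1]
    rfl
  have h₁ := Finset.sum_range_succ (fun i : ℕ => L (n - i)) k
  rw [Finset.sum_range_succ', ← key] at h₁
  have h₂ := key (n + 1)
  simp only [Nat.cast_add, Nat.cast_one, add_sub_add_right_eq_sub] at h₂
  rw [← h₂] at h₁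
  simp only [Nat.cast_zero, sub_zero] at h₁
  linarith

lemma apply_one_sub_order (hk : 3 ≤ k) (hL : IsGenLucas k L) : L (1 - k) = -1 := by
  obtain ⟨m, rfl⟩ : ∃ m, k = m + 1 := ⟨k - 1, by omega⟩
  have h := hL.1 1
  rw [Finset.sum_Icc_succ_top (by omega), Finset.sum_eq_single_of_mem 1 (by simp; omega)] at h
  · simp only [Nat.cast_one, sub_self, hL.2.1, hL.2.2.1] at h
    linarith
  · intro i hi hi'
    rw [Finset.mem_Icc] at hi
    exact hL.2.2.2 _ (by push_cast; omega) (by omega)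

/-- Values of `L` at negative indices in terms of the coefficients of its generating function. -/
lemma apply_eq_lucasCoeff (hk : 3 ≤ k) (hL : IsGenLucas k L) (q : ℕ) (hq : 1 ≤ q)
    (hqk : q < 2 * k) (r : ℤ) (hr : -1 ≤ r) (hrk : r < k) :
    (L (1 - q * k - r) : ℚ) = lucasCoeff q r + lucasCoeff (q - 1) (r + k) := by
  induction q, hq using Nat.le_induction generalizing r with
  | base =>
    simp only [Nat.cast_one, one_mul, sub_self]
    rw [lucasCoeff_eq_zero_of_lt (q := 0) (by omega), add_zero]
    have h₀ := hL.2.1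
    have h₁ := hL.2.2.1
    have h₂ := hL.2.2.2
    have hs := hL.sub_order (1 - r)
    rw [show (1 : ℤ) - r - k = 1 - k - r by ring] at hs
    obtain rfl | rfl | rfl | rfl | h : r = -1 ∨ r = 0 ∨ r = 1 ∨ r = 2 ∨ 3 ≤ r := by omega
    · rw [lucasCoeff_eq_zero_of_neg (by norm_num), h₂ _ (by omega) (by omega)]
      norm_num
    · rw [sub_zero, hL.apply_one_sub_order hk]
      norm_num [lucasCoeff, twoSubCoeff, C]
    · norm_num [h₀, h₁] at hs
      rw [show (1 : ℤ) - k - 1 = -k by ring, hs]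
      norm_num [lucasCoeff, twoSubCoeff, C]
    · norm_num [h₀, h₂ (-1) (by omega) (by omega)] at hs
      rw [hs]
      norm_num [lucasCoeff, twoSubCoeff, C]
    · rw [lucasCoeff_eq_zero_of_lt (by omega), hs, h₂ _ (by omega) (by omega),
        h₂ _ (by omega) (by omega)]
      norm_num
  | succ q hq ih =>
    push_cast
    rw [add_sub_cancel_right]
    obtain rfl | h : r = -1 ∨ 0 ≤ r := by omega
    · have := ih (by omega) (k - 1) (by omega) (by omega)
      rw [lucasCoeff_eq_zero_of_lt (q := q - 1) (by omega)] at this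
      rw [lucasCoeff_eq_zero_of_neg (by norm_num), zero_add,
        show (1 : ℤ) - (q + 1) * k - -1 = 1 - q * k - (k - 1) by ring, this, add_zero,
        neg_add_eq_sub]
    · have hs := hL.sub_order (1 - q * k - r)
      rw [show (1 : ℤ) - q * k - r - k = 1 - (q + 1) * k - r by ring,
        show (1 : ℤ) - q * k - r + 1 = 1 - q * k - (r - 1) by ring] at hs
      have c₁ := lucasCoeff_succ q r (by omega)
      have c₂ := lucasCoeff_succ (q - 1) (r + k) (by omega)
      rw [sub_add_cancel, show r + (k : ℤ) - 1 = r - 1 + k by ring] at c₂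
      rw [hs, c₁, c₂]
      push_cast
      rw [ih (by omega) r hr hrk, ih (by omega) (r - 1) (by omega) (by omega)]
      ring

end IsGenLucas

theorem value_second_block (k : ℕ) (hk : 3 ≤ k) (L : ℤ → ℤ) (hL : IsGenLucas k L)
    (j r : ℤ) (hj1 : 0 ≤ j) (hj2 : j ≤ (k : ℤ) - 2) (hr1 : 0 ≤ r) (hr2 : r ≤ (k : ℤ) - 2) :
    (L (-((k : ℤ) ^ 2 - k - 1 + (j - 1) * k + r)) : ℚ) =
      (-1 : ℚ) ^ (r + 1) *
        ((psi ((k : ℤ) + j - 3) (r - 2) : ℚ) * (2 : ℚ) ^ ((k : ℤ) + j - r - 1) +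
          (psi ((k : ℤ) + j - 3) (r - 1) : ℚ) * (2 : ℚ) ^ ((k : ℤ) + j - r - 3)) +
      (-1 : ℚ) ^ ((k : ℤ) + r + 1) *
        ((psi ((k : ℤ) + j - 4) ((k : ℤ) + r - 2) : ℚ) * (2 : ℚ) ^ (j - r - 2) +
          (psi ((k : ℤ) + j - 4) ((k : ℤ) + r - 1) : ℚ) * (2 : ℚ) ^ (j - r - 4)) := by
  obtain ⟨q, hq⟩ : ∃ q : ℕ, (q : ℤ) = k + j - 2 := ⟨(k + j - 2).toNat, by omega⟩
  have h := hL.apply_eq_lucasCoeff hk q (by omega) (by omega) r (by omega) (by omega)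
  rw [lucasCoeff_eq_psi _ _ (by omega), lucasCoeff_eq_psi _ _ (by omega), hq] at h
  convert h using 3 <;> ring_nf
end
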